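/- The tight tractable remainder-form decomposition functions are valid framers (Theorem 2, framer property of each term of the minimum/maximum): Let p ≤ q in Fin n → ℝ (componentwise), let f : (Fin n → ℝ) → ℝ be continuous on Set.Icc p q, let m : Fin n → ℝ and S ⊆ Fin n be such that m j ≥ 0 for j ∈ S and m j ≤ 0 for j ∉ S, and suppose for every z ∈ Set.Icc p q: for j ∈ S, the Clarke upper directional derivative f°(z, Pi.single j 1) ≤ (m j : EReal), and for j ∉ S, the Clarke lower directional derivative f_○(z, Pi.single j 1) ≥ (m j : EReal). Define ζ⁺ j := if j ∈ S then p j else q j, ζ⁻ j := if j ∈ S then q j else p j, and Δ := ∑ j, m j * (ζ⁻ j - ζ⁺ j). Then for every z ∈ Set.Icc p q: f ζ⁻ - Δ ≤ f z ≤ f ζ⁺ + Δ; that is, [f ζ⁻ - Δ, f ζ⁺ + Δ] is an interval over-approximation of the range of f over the box, given by the remainder-form upper and lower decomposition functions with linear remainder ⟨m, ·⟩ evaluated at the box endpoints. -/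

import Mathlib

/-- Clarke (generalized) upper directional derivative of `f` at `z` in direction `v`. -/
noncomputable def clarkeUpper {E : Type*} [NormedAddCommGroup E] [NormedSpace ℝ E]
    (f : E → ℝ) (z v : E) : EReal :=
  Filter.limsup
    (fun tl : E × ℝ => (((f (tl.1 + tl.2 • v) - f tl.1) / tl.2 : ℝ) : EReal))
    ((nhds z) ×ˢ (nhdsWithin 0 (Set.Ioi 0)))

/-- Clarke (generalized) lower directional derivative of `f` at `z` in direction `v`. -/
noncomputable def clarkeLower {E : Type*} [NormedAddCommGroup E] [NormedSpace ℝ E]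
    (f : E → ℝ) (z v : E) : EReal :=
  Filter.liminf
    (fun tl : E × ℝ => (((f (tl.1 + tl.2 • v) - f tl.1) / tl.2 : ℝ) : EReal))
    ((nhds z) ×ˢ (nhdsWithin 0 (Set.Ioi 0)))

open Filter Topology Set

/-- If the Clarke upper derivative in direction `v` is at most `c`, then the right difference
quotients at `z` along `v` are eventually below any `r > c`. -/
theorem eventually_quotient_lt_of_clarkeUpper_le {E : Type*} [NormedAddCommGroup E]
    [NormedSpace ℝ E] {f : E → ℝ} {z v : E} {c r : ℝ} (h : clarkeUpper f z v ≤ (c : EReal))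
    (hr : c < r) : ∀ᶠ t in 𝓝[>] (0 : ℝ), (f (z + t • v) - f z) / t < r := by
  have hev := eventually_lt_of_limsup_lt (h.trans_lt (EReal.coe_lt_coe_iff.2 hr))
  have htend : Tendsto (fun t : ℝ => (z, t)) (𝓝[>] (0 : ℝ)) (𝓝 z ×ˢ 𝓝[>] (0 : ℝ)) :=
    tendsto_const_nhds.prodMk tendsto_id
  exact (htend.eventually hev).mono fun t ht => EReal.coe_lt_coe_iff.1 ht

theorem clarkeUpper_neg {E : Type*} [NormedAddCommGroup E] [NormedSpace ℝ E] (f : E → ℝ)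
    (z v : E) : clarkeUpper (fun x => -f x) z v = -clarkeLower f z v := by
  rw [clarkeUpper, clarkeLower, ← EReal.limsup_neg]
  congr 1
  ext tl
  rw [Pi.neg_apply, ← EReal.coe_neg]
  congr 1
  ring

/-- A bound on the Clarke upper derivative along a segment bounds the increment of `f`. -/
theorem le_add_mul_of_clarkeUpper_le {E : Type*} [NormedAddCommGroup E] [NormedSpace ℝ E]
    {f : E → ℝ} {s : Set E} (hf : ContinuousOn f s) {x v : E} {c T : ℝ} (hT : 0 ≤ T)
    (hs : ∀ t ∈ Icc 0 T, x + t • v ∈ s) (h : ∀ z ∈ s, clarkeUpper f z v ≤ (c : EReal)) :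
    f (x + T • v) ≤ f x + c * T := by
  have hcont : ContinuousOn (fun t : ℝ => f (x + t • v)) (Icc 0 T) :=
    hf.comp (by fun_prop) hs
  refine image_le_of_liminf_slope_right_le_deriv_boundary (B := fun t => f x + c * t)
    (B' := fun _ => c) hcont (by simp) (by fun_prop)
    (fun t _ => by
      simpa using (((hasDerivAt_id t).const_mul c).const_add (f x)).hasDerivWithinAt)
    (fun t ht r hr => Eventually.frequently ?_) (right_mem_Icc.2 hT)
  have hev := eventually_quotient_lt_of_clarkeUpper_le (h _ (hs t (Ico_subset_Icc_self ht))) hr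
  have htend : Tendsto (fun u : ℝ => u - t) (𝓝[>] t) (𝓝[>] 0) := by
    refine tendsto_nhdsWithin_iff.2 ⟨?_, ?_⟩
    · have : Tendsto (fun u : ℝ => u - t) (𝓝 t) (𝓝 (t - t)) :=
        (continuous_id.sub continuous_const).tendsto t
      rw [sub_self] at this
      exact this.mono_left nhdsWithin_le_nhds
    · filter_upwards [self_mem_nhdsWithin] with u (hu : t < u) using sub_pos.2 hu
  filter_upwards [htend.eventually hev] with u hu
  rwa [add_assoc, ← add_smul, add_sub_cancel, ← slope_def_field (fun t : ℝ => f (x + t • v))] at hu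

/-- Increment bound when a single coordinate moves inside the box. -/
theorem update_le_add_mul_of_clarke_bounds {n : ℕ} {p q : Fin n → ℝ} {f : (Fin n → ℝ) → ℝ}
    (hf : ContinuousOn f (Icc p q)) {x : Fin n → ℝ} (hx : x ∈ Icc p q) {j : Fin n} {a c : ℝ}
    (ha : a ∈ Icc (p j) (q j))
    (h : (x j ≤ a ∧ ∀ z ∈ Icc p q, clarkeUpper f z (Pi.single j 1) ≤ (c : EReal)) ∨
      (a ≤ x j ∧ ∀ z ∈ Icc p q, (c : EReal) ≤ clarkeLower f z (Pi.single j 1))) :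
    f (Function.update x j a) ≤ f x + c * (a - x j) := by
  have hadd : ∀ (w : Fin n → ℝ) (t : ℝ),
      w + t • Pi.single j 1 = Function.update w j (w j + t) := by
    intro w t
    ext i
    rcases eq_or_ne i j with rfl | hi <;> simp [*]
  have hbox : ∀ b ∈ Icc (p j) (q j), Function.update x j b ∈ Icc p q := fun b hb =>
    ⟨le_update_iff.2 ⟨hb.1, fun i _ => hx.1 i⟩, update_le_iff.2 ⟨hb.2, fun i _ => hx.2 i⟩⟩
  rcases h with ⟨hxa, h⟩ | ⟨hxa, h⟩
  · have key := le_add_mul_of_clarkeUpper_le hf (x := x) (sub_nonneg.2 hxa)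
      (fun t ht => by
        rw [hadd]
        exact hbox _ ⟨by linarith [hx.1 j, ht.1], by linarith [ht.2, ha.2]⟩) h
    rwa [hadd, add_sub_cancel] at key
  · have hneg : ∀ z ∈ Icc p q,
        clarkeUpper (fun y => -f y) z (Pi.single j 1) ≤ ((-c : ℝ) : EReal) := fun z hz => by
      rw [clarkeUpper_neg, EReal.coe_neg]
      exact EReal.neg_le_neg_iff.2 (h z hz)
    have key := le_add_mul_of_clarkeUpper_le hf.neg (x := Function.update x j a)
      (sub_nonneg.2 hxa)
      (fun t ht => by
        rw [hadd, Function.update_self, Function.update_idem]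
        exact hbox _ ⟨by linarith [ha.1, ht.1], by linarith [ht.2, hx.2 j]⟩) hneg
    rw [hadd, Function.update_self, Function.update_idem, add_sub_cancel,
      Function.update_eq_self, Pi.neg_apply, Pi.neg_apply] at key
    linarith

/-- Increment bound between two points of the box whose difference has the sign pattern of `S`. -/
theorem le_add_sum_of_clarke_bounds {n : ℕ} {p q : Fin n → ℝ} {f : (Fin n → ℝ) → ℝ}
    (hf : ContinuousOn f (Icc p q)) {m : Fin n → ℝ} {S : Set (Fin n)}
    (hup : ∀ j ∈ S, ∀ z ∈ Icc p q, clarkeUpper f z (Pi.single j 1) ≤ ((m j : ℝ) : EReal))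
    (hlo : ∀ j ∉ S, ∀ z ∈ Icc p q, ((m j : ℝ) : EReal) ≤ clarkeLower f z (Pi.single j 1))
    {x y : Fin n → ℝ} (hx : x ∈ Icc p q) (hy : y ∈ Icc p q) (hS : ∀ j ∈ S, x j ≤ y j)
    (hS' : ∀ j ∉ S, y j ≤ x j) : f y ≤ f x + ∑ j, m j * (y j - x j) := by
  suffices H : ∀ T : Finset (Fin n),
      f (T.piecewise y x) ≤ f x + ∑ j ∈ T, m j * (y j - x j) by
    simpa using H Finset.univ
  intro T
  induction T using Finset.induction_on with
  | empty => simp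
  | insert j T hj ih =>
    have hmem : T.piecewise y x ∈ Icc p q :=
      ⟨T.le_piecewise_of_le_of_le hy.1 hx.1, T.piecewise_le_of_le_of_le hy.2 hx.2⟩
    have hval : T.piecewise y x j = x j := T.piecewise_eq_of_notMem _ _ hj
    have step := update_le_add_mul_of_clarke_bounds hf hmem (c := m j) ⟨hy.1 j, hy.2 j⟩ (by
      rw [hval]
      by_cases hjS : j ∈ S
      · exact Or.inl ⟨hS j hjS, hup j hjS⟩
      · exact Or.inr ⟨hS' j hjS, hlo j hjS⟩)
    rw [hval] at step
    rw [Finset.piecewise_insert, Finset.sum_insert hj]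
    linarith

/-- Theorem 2 (framer property): the remainder-form upper and lower decomposition
functions with linear remainder `⟨m, ·⟩`, evaluated at the box endpoints, give a
valid interval over-approximation `[f ζ⁻ - Δ, f ζ⁺ + Δ]` of the range of `f`. -/
theorem stmt_12 {n : ℕ} (p q : Fin n → ℝ) (hpq : p ≤ q)
    (f : (Fin n → ℝ) → ℝ) (hfc : ContinuousOn f (Set.Icc p q))
    (m : Fin n → ℝ) (S : Set (Fin n)) [DecidablePred (· ∈ S)]
    (hmS : ∀ j ∈ S, 0 ≤ m j) (hmS' : ∀ j ∉ S, m j ≤ 0)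
    (hup : ∀ j ∈ S, ∀ z ∈ Set.Icc p q,
      clarkeUpper f z (Pi.single j 1) ≤ ((m j : ℝ) : EReal))
    (hlo : ∀ j ∉ S, ∀ z ∈ Set.Icc p q,
      ((m j : ℝ) : EReal) ≤ clarkeLower f z (Pi.single j 1)) :
    let ζp : Fin n → ℝ := fun j => if j ∈ S then p j else q j
    let ζm : Fin n → ℝ := fun j => if j ∈ S then q j else p j
    let Δ : ℝ := ∑ j, m j * (ζm j - ζp j)
    ∀ z ∈ Set.Icc p q, f ζm - Δ ≤ f z ∧ f z ≤ f ζp + Δ := by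
  intro ζp ζm Δ z hz
  have hζp : ζp ∈ Icc p q := by
    constructor <;> intro j <;> by_cases hj : j ∈ S <;> simp [ζp, hj, hpq j]
  have hζm : ζm ∈ Icc p q := by
    constructor <;> intro j <;> by_cases hj : j ∈ S <;> simp [ζm, hj, hpq j]
  have hlower := le_add_sum_of_clarke_bounds hfc hup hlo hz hζm
    (fun j hj => by simpa [ζm, hj] using hz.2 j) (fun j hj => by simpa [ζm, hj] using hz.1 j)
  have hupper := le_add_sum_of_clarke_bounds hfc hup hlo hζp hz
    (fun j hj => by simpa [ζp, hj] using hz.1 j) (fun j hj => by simpa [ζp, hj] using hz.2 j)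
  have hΔm : ∑ j, m j * (ζm j - z j) ≤ Δ := by
    refine Finset.sum_le_sum fun j _ => ?_
    by_cases hj : j ∈ S
    · have h1 : ζp j ≤ z j := by simpa [ζp, hj] using hz.1 j
      exact mul_le_mul_of_nonneg_left (by linarith) (hmS j hj)
    · have h1 : z j ≤ ζp j := by simpa [ζp, hj] using hz.2 j
      exact mul_le_mul_of_nonpos_left (by linarith) (hmS' j hj)
  have hΔp : ∑ j, m j * (z j - ζp j) ≤ Δ := by
    refine Finset.sum_le_sum fun j _ => ?_
    by_cases hj : j ∈ S
    · have h1 : z j ≤ ζm j := by simpa [ζm, hj] using hz.2 j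
      exact mul_le_mul_of_nonneg_left (by linarith) (hmS j hj)
    · have h1 : ζm j ≤ z j := by simpa [ζm, hj] using hz.1 j
      exact mul_le_mul_of_nonpos_left (by linarith) (hmS' j hj)
  exact ⟨by linarith, by linarith⟩
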